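/- Define Θ : ℝ² → ℝ² by Θ(t₁, t₂) = (t₁, t₁²/2 + t₂). Then: (i) Θ is a bijection of ℝ² onto itself that preserves two-dimensional Lebesgue measure (the pushforward of Lebesgue measure under Θ is Lebesgue measure); (ii) the family of translates { Θ([-1/2, 1/2)²) + k : k ∈ ℤ² } is a partition of ℝ², i.e. every point of ℝ² belongs to exactly one set Θ([-1/2,1/2)²) + k with k ∈ ℤ². -/

import Mathlib

open MeasureTheory

/-- The map `Θ(t₁, t₂) = (t₁, t₁²/2 + t₂)` of Example 3.4 of the paper. -/
noncomputable def thetaMap : ℝ × ℝ → ℝ × ℝ := fun t => (t.1, t.1 ^ 2 / 2 + t.2)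

/-- The map `Θ(t₁,t₂) = (t₁, t₁²/2 + t₂)` is a measure-preserving
bijection of `ℝ²`, and the integer translates of `Θ([-1/2, 1/2)²)` partition `ℝ²`:
every point of `ℝ²` lies in exactly one set `Θ([-1/2,1/2)²) + k`, `k ∈ ℤ²`. -/
theorem stmt_13 :
    Function.Bijective thetaMap ∧
    MeasurePreserving thetaMap (volume : Measure (ℝ × ℝ)) volume ∧
    ∀ x : ℝ × ℝ, ∃! k : ℤ × ℤ,
      x ∈ (fun ξ : ℝ × ℝ => ξ + ((k.1 : ℝ), (k.2 : ℝ))) ''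
        (thetaMap '' (Set.Ico (-(1 / 2 : ℝ)) (1 / 2) ×ˢ Set.Ico (-(1 / 2 : ℝ)) (1 / 2))) := by
  refine ⟨⟨?_, ?_⟩, ?_, ?_⟩
  · rintro ⟨a, b⟩ ⟨c, d⟩ h
    simp only [thetaMap, Prod.mk.injEq] at h
    obtain ⟨rfl, h⟩ := h
    simpa using h
  · rintro ⟨a, b⟩
    exact ⟨(a, b - a ^ 2 / 2), by simp [thetaMap]⟩
  · have h := MeasurePreserving.skew_product (μa := (volume : Measure ℝ))
      (μc := (volume : Measure ℝ)) (μd := (volume : Measure ℝ))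
      (MeasurePreserving.id (volume : Measure ℝ))
      (g := fun a b => a ^ 2 / 2 + b) (by unfold Function.uncurry; fun_prop)
      (Filter.Eventually.of_forall fun a => (measurePreserving_add_left volume (a ^ 2 / 2)).map_eq)
    exact h
  · rintro ⟨a, b⟩
    have key : ∀ k : ℤ × ℤ, ((a, b) ∈ (fun ξ : ℝ × ℝ => ξ + ((k.1 : ℝ), (k.2 : ℝ))) ''
        (thetaMap '' (Set.Ico (-(1 / 2 : ℝ)) (1 / 2) ×ˢ Set.Ico (-(1 / 2 : ℝ)) (1 / 2)))) ↔
        (k.1 = ⌊a + 1 / 2⌋ ∧ k.2 = ⌊b - (a - k.1) ^ 2 / 2 + 1 / 2⌋) := by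
      rintro ⟨m, n⟩
      rw [eq_comm, Int.floor_eq_iff, eq_comm, Int.floor_eq_iff]
      constructor
      · rintro ⟨_, ⟨⟨s, t⟩, ⟨⟨h1, h2⟩, h3, h4⟩, rfl⟩, h⟩
        simp only [thetaMap, Prod.mk_add_mk, Prod.mk.injEq] at h h1 h2 h3 h4 ⊢
        obtain ⟨rfl, rfl⟩ := h
        rw [add_sub_cancel_right]
        refine ⟨⟨?_, ?_⟩, ?_, ?_⟩ <;> linarith
      · rintro ⟨⟨h1, h2⟩, h3, h4⟩
        simp only at h1 h2 h3 h4
        refine ⟨_, ⟨(a - m, b - n - (a - m) ^ 2 / 2), ⟨⟨?_, ?_⟩, ?_, ?_⟩, rfl⟩, ?_⟩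
        · simp only; linarith
        · simp only; linarith
        · simp only; linarith
        · simp only; linarith
        · simp [thetaMap]
    refine ⟨(⌊a + 1 / 2⌋, ⌊b - (a - ⌊a + 1 / 2⌋) ^ 2 / 2 + 1 / 2⌋), (key _).2 ⟨rfl, rfl⟩, ?_⟩
    rintro ⟨m, n⟩ h
    obtain ⟨h1, h2⟩ := (key _).1 h
    simp only at h1 h2
    subst h1
    rw [← h2]
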